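/- For every closed term P over Σ_CP(A), mbf(P) is a mem-basic form. -/

import Mathlib

/-- Closed terms over Σ_CP(A): constants T, F, atoms, and the ternary conditional. -/
inductive CTerm (A : Type) : Type
  | T : CTerm A
  | F : CTerm A
  | at_ : A → CTerm A
  | cond : CTerm A → CTerm A → CTerm A → CTerm A

/-- The substitution P[T↦Q, F↦R] (defined on basic forms; extended trivially elsewhere). -/
def subst {A : Type} (Q R : CTerm A) : CTerm A → CTerm A
  | CTerm.T => Q
  | CTerm.F => R
  | CTerm.at_ a => CTerm.at_ a
  | CTerm.cond p1 c p2 => CTerm.cond (subst Q R p1) c (subst Q R p2)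

/-- The basic form function bf. -/
def bf {A : Type} : CTerm A → CTerm A
  | CTerm.T => CTerm.T
  | CTerm.F => CTerm.F
  | CTerm.at_ a => CTerm.cond CTerm.T (CTerm.at_ a) CTerm.F
  | CTerm.cond p q r => subst (bf p) (bf r) (bf q)

/-- Occurrence of an atom in a term. -/
def occurs {A : Type} (a : A) : CTerm A → Prop
  | CTerm.T => False
  | CTerm.F => False
  | CTerm.at_ b => b = a
  | CTerm.cond p q r => occurs a p ∨ occurs a q ∨ occurs a r

/-- Mem-basic forms over A. -/
inductive IsMemBasic {A : Type} : CTerm A → Prop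
  | T : IsMemBasic CTerm.T
  | F : IsMemBasic CTerm.F
  | cond {p q : CTerm A} (a : A) : IsMemBasic p → IsMemBasic q →
      ¬ occurs a p → ¬ occurs a q →
      IsMemBasic (CTerm.cond p (CTerm.at_ a) q)

/-- Left-a-reduction ℓ_a (defined on basic forms; extended trivially elsewhere). -/
def la {A : Type} [DecidableEq A] (a : A) : CTerm A → CTerm A
  | CTerm.T => CTerm.T
  | CTerm.F => CTerm.F
  | CTerm.at_ b => CTerm.at_ b
  | CTerm.cond p (CTerm.at_ b) q =>
      if b = a then la a p else CTerm.cond (la a p) (CTerm.at_ b) (la a q)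
  | CTerm.cond p c q => CTerm.cond (la a p) c (la a q)

/-- Right-a-reduction r_a (defined on basic forms; extended trivially elsewhere). -/
def ra {A : Type} [DecidableEq A] (a : A) : CTerm A → CTerm A
  | CTerm.T => CTerm.T
  | CTerm.F => CTerm.F
  | CTerm.at_ b => CTerm.at_ b
  | CTerm.cond p (CTerm.at_ b) q =>
      if b = a then ra a q else CTerm.cond (ra a p) (CTerm.at_ b) (ra a q)
  | CTerm.cond p c q => CTerm.cond (ra a p) c (ra a q)

/-- Size of a term (used for termination of `mf`). -/
def sz {A : Type} : CTerm A → Nat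
  | CTerm.T => 1
  | CTerm.F => 1
  | CTerm.at_ _ => 1
  | CTerm.cond p q r => sz p + sz q + sz r + 1

theorem la_sz {A : Type} [DecidableEq A] (a : A) (p : CTerm A) : sz (la a p) ≤ sz p := by
  induction p with
  | T => simp [la, sz]
  | F => simp [la, sz]
  | at_ b => simp [la, sz]
  | cond p c q ihp ihc ihq =>
      cases c with
      | at_ b =>
          simp only [la]
          split
          · simp only [sz]; omega
          · simp only [sz]; omega
      | T => simp only [la, sz]; omega
      | F => simp only [la, sz]; omega
      | cond c1 c2 c3 => simp only [la, sz]; omega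

theorem ra_sz {A : Type} [DecidableEq A] (a : A) (p : CTerm A) : sz (ra a p) ≤ sz p := by
  induction p with
  | T => simp [ra, sz]
  | F => simp [ra, sz]
  | at_ b => simp [ra, sz]
  | cond p c q ihp ihc ihq =>
      cases c with
      | at_ b =>
          simp only [ra]
          split
          · simp only [sz]; omega
          · simp only [sz]; omega
      | T => simp only [ra, sz]; omega
      | F => simp only [ra, sz]; omega
      | cond c1 c2 c3 => simp only [ra, sz]; omega

/-- The function mf (defined on basic forms; extended trivially elsewhere). -/
def mf {A : Type} [DecidableEq A] : CTerm A → CTerm A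
  | CTerm.T => CTerm.T
  | CTerm.F => CTerm.F
  | CTerm.at_ b => CTerm.at_ b
  | CTerm.cond p (CTerm.at_ a) q =>
      CTerm.cond (mf (la a p)) (CTerm.at_ a) (mf (ra a q))
  | CTerm.cond p c q => CTerm.cond (mf p) c (mf q)
termination_by t => sz t
decreasing_by
  all_goals simp only [sz]
  all_goals try omega
  all_goals first
    | exact lt_of_le_of_lt (la_sz _ _) (by omega)
    | exact lt_of_le_of_lt (ra_sz _ _) (by omega)

/-- The mem-basic form function. -/
def mbf {A : Type} [DecidableEq A] (P : CTerm A) : CTerm A := mf (bf P)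

/-- Basic forms: terms all of whose central conditions are atoms. -/
inductive IsBasic {A : Type} : CTerm A → Prop
  | T : IsBasic CTerm.T
  | F : IsBasic CTerm.F
  | cond {p q : CTerm A} (a : A) : IsBasic p → IsBasic q →
      IsBasic (CTerm.cond p (CTerm.at_ a) q)

theorem IsBasic.subst {A : Type} {p q r : CTerm A} (hp : IsBasic p) (hq : IsBasic q)
    (hr : IsBasic r) : IsBasic (subst q r p) := by
  induction hp with
  | T => exact hq
  | F => exact hr
  | cond a _ _ ih₁ ih₂ => exact .cond a ih₁ ih₂

theorem isBasic_bf {A : Type} (p : CTerm A) : IsBasic (bf p) := by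
  induction p with
  | T => exact .T
  | F => exact .F
  | at_ a => exact .cond a .T .F
  | cond _ _ _ ihp ihq ihr => exact ihq.subst ihp ihr

section Reduction

variable {A : Type} [DecidableEq A]

theorem IsBasic.la {p : CTerm A} (hp : IsBasic p) (a : A) : IsBasic (la a p) := by
  induction hp with
  | T => exact .T
  | F => exact .F
  | cond b _ _ ih₁ ih₂ =>
    simp only [_root_.la]
    split
    · exact ih₁
    · exact .cond b ih₁ ih₂

theorem IsBasic.ra {p : CTerm A} (hp : IsBasic p) (a : A) : IsBasic (ra a p) := by
  induction hp with
  | T => exact .T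
  | F => exact .F
  | cond b _ _ ih₁ ih₂ =>
    simp only [_root_.ra]
    split
    · exact ih₂
    · exact .cond b ih₁ ih₂

theorem IsBasic.occurs_of_occurs_la {p : CTerm A} (hp : IsBasic p) {a b : A}
    (h : occurs b (_root_.la a p)) : b ≠ a ∧ occurs b p := by
  induction hp with
  | T => exact h.elim
  | F => exact h.elim
  | cond c _ _ ih₁ ih₂ =>
    simp only [_root_.la] at h
    split at h <;> simp only [occurs] at h ⊢ <;> grind

theorem IsBasic.occurs_of_occurs_ra {p : CTerm A} (hp : IsBasic p) {a b : A}
    (h : occurs b (_root_.ra a p)) : b ≠ a ∧ occurs b p := by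
  induction hp with
  | T => exact h.elim
  | F => exact h.elim
  | cond c _ _ ih₁ ih₂ =>
    simp only [_root_.ra] at h
    split at h <;> simp only [occurs] at h ⊢ <;> grind

/-- On basic forms, `mf` yields mem-basic forms and introduces no new atoms. -/
theorem IsBasic.isMemBasic_mf {p : CTerm A} (hp : IsBasic p) :
    IsMemBasic (mf p) ∧ ∀ b, occurs b (mf p) → occurs b p := by
  induction hn : sz p using Nat.strong_induction_on generalizing p with
  | _ n ih =>
    cases hp with
    | T => simpa [mf] using IsMemBasic.T
    | F => simpa [mf] using IsMemBasic.F
    | @cond p q a hp hq =>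
      simp only [sz] at hn
      obtain ⟨hl, hlo⟩ := ih _ (by have := la_sz a p; omega) (hp.la a) rfl
      obtain ⟨hr, hro⟩ := ih _ (by have := ra_sz a q; omega) (hq.ra a) rfl
      rw [mf]
      refine ⟨.cond a hl hr (fun h => (hp.occurs_of_occurs_la (hlo a h)).1 rfl)
        (fun h => (hq.occurs_of_occurs_ra (hro a h)).1 rfl), fun b h => ?_⟩
      rcases h with h | h | h
      · exact .inl (hp.occurs_of_occurs_la (hlo b h)).2
      · exact .inr (.inl h)
      · exact .inr (.inr (hq.occurs_of_occurs_ra (hro b h)).2)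

end Reduction

/-- For every closed term P over Σ_CP(A), mbf(P) is a mem-basic form. -/
theorem mbf_isMemBasic {A : Type} [DecidableEq A] (P : CTerm A) :
    IsMemBasic (mbf P) := by
  exact (isBasic_bf P).isMemBasic_mf.1
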